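/- Let Z ⊆ S² be a compact, connected, locally connected subset whose complement in S² is connected (Z does not separate the sphere). Suppose F and G are Thurston maps of degree 2 such that F = G on Z, the post-critical sets satisfy P_F = P_G ⊆ Z, and F and G coincide on some open neighborhood of each critical point of F (in particular, F and G have the same critical points). Then F and G are Thurston equivalent. -/

import Mathlib

open Set Filter Topology

noncomputable section

abbrev Sph : Type := Metric.sphere (0 : EuclideanSpace ℝ (Fin 3)) 1

/-- The open unit disk in ℂ. -/
def unitDisk : Set ℂ := Metric.ball 0 1

/-- `f` is a ramified covering of local degree `k` at `x`: in suitable local homeomorphic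
coordinates identifying neighborhoods of `x` and `f x` with the unit disk (sending `x` and
`f x` to `0`), the map `f` becomes `z ↦ z ^ k`. -/
def IsRamifiedAt (f : Sph → Sph) (x : Sph) (k : ℕ) : Prop :=
  0 < k ∧ ∃ (U V : Set Sph) (hx : x ∈ U) (hfx : f x ∈ V) (hmap : Set.MapsTo f U V),
    IsOpen U ∧ IsOpen V ∧
      ∃ (φ : U ≃ₜ unitDisk) (ψ : V ≃ₜ unitDisk),
        (φ ⟨x, hx⟩ : ℂ) = 0 ∧ (ψ ⟨f x, hfx⟩ : ℂ) = 0 ∧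
          ∀ z : U, (ψ ⟨f z, hmap z.2⟩ : ℂ) = (φ z : ℂ) ^ k

/-- `f` is a ramified covering: a continuous map that is a ramified covering of some local
degree at every point. -/
def IsRamifiedCovering (f : Sph → Sph) : Prop :=
  Continuous f ∧ ∀ x : Sph, ∃ k : ℕ, IsRamifiedAt f x k

/-- A critical point of `f` is a point of local degree at least 2. -/
def IsCriticalPt (f : Sph → Sph) (x : Sph) : Prop := ∃ k, 2 ≤ k ∧ IsRamifiedAt f x k

/-- A critical value of `f` is the image of a critical point. -/
def IsCriticalValue (f : Sph → Sph) (y : Sph) : Prop := ∃ x, IsCriticalPt f x ∧ f x = y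

/-- The post-critical set of `F`: the union of the forward orbits (from time 1 on) of the
critical points of `F`. -/
def postCritical (F : Sph → Sph) : Set Sph :=
  ⋃ n ∈ {n : ℕ | 1 ≤ n}, F^[n] '' {x | IsCriticalPt F x}

/-- A Thurston map: a ramified covering of the sphere with finite post-critical set. -/
def IsThurstonMap (F : Sph → Sph) : Prop :=
  IsRamifiedCovering F ∧ (postCritical F).Finite

/-- `F` has degree 2: every point that is not a critical value has exactly two preimages. -/
def HasDegreeTwo (F : Sph → Sph) : Prop :=
  ∀ y : Sph, ¬IsCriticalValue F y → Nat.card (F ⁻¹' {y} : Set Sph) = 2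

/-- Thurston equivalence of two Thurston maps `F` and `G`: there are homeomorphisms `φ, ψ` of
the sphere with `φ ∘ F = G ∘ ψ` such that `φ` and `ψ` are homotopic relative to the
post-critical set of `F`. -/
def ThurstonEquiv (F G : Sph → Sph) : Prop :=
  ∃ φ ψ : Sph ≃ₜ Sph, (∀ x, φ (F x) = G (ψ x)) ∧
    ContinuousMap.HomotopicRel (φ : C(Sph, Sph)) (ψ : C(Sph, Sph)) (postCritical F)

def hpl (R : ℝ) : Set ℂ := {w : ℂ | w.re < R}

lemma hpl_convex (R : ℝ) : Convex ℝ (hpl R) := convex_halfSpace_re_lt R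

lemma hpl_open (R : ℝ) : IsOpen (hpl R) := isOpen_lt Complex.continuous_re continuous_const

lemma hpl_nonempty (R : ℝ) : (hpl R).Nonempty :=
  ⟨((R - 1 : ℝ) : ℂ), by simp [hpl]⟩

lemma hpl_sc (R : ℝ) : IsSimplyConnected (hpl R) := by
  have : ContractibleSpace (hpl R) := (hpl_convex R).contractibleSpace (hpl_nonempty R)
  exact SimplyConnectedSpace.ofContractible _

lemma univ_sc : IsSimplyConnected (Set.univ : Set ℂ) := by
  have : ContractibleSpace (Set.univ : Set ℂ) := convex_univ.contractibleSpace univ_nonempty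
  exact SimplyConnectedSpace.ofContractible _

lemma hpl_add {R : ℝ} {w : ℂ} (hw : w ∈ hpl R) : w + 2 * Real.pi * Complex.I ∈ hpl R := by
  simpa [hpl] using hw

lemma hpl_add_iff {R : ℝ} {w : ℂ} : w + 2 * (2 * Real.pi * Complex.I) ∈ hpl R ↔ w ∈ hpl R := by
  simp [hpl]

lemma hpl_exp {r : ℝ} (hr : 0 < r) {w : ℂ} : w ∈ hpl (Real.log r) ↔ ‖Complex.exp w‖ < r := by
  rw [Complex.norm_exp, ← Real.lt_log_iff_exp_lt hr]; rfl

lemma exp_add_two (w : ℂ) : Complex.exp (w + 2 * Real.pi * Complex.I) = Complex.exp w :=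
  Complex.exp_periodic w

lemma hloc_of_chart (f φ u : ℂ → ℂ) (ε δ : ℝ) (hε : 0 < ε) (hδ : 0 < δ)
    (hφ : ContinuousOn φ (Metric.ball 0 ε)) (hu : ContinuousOn u (Metric.ball 0 δ))
    (hφ0 : ∀ x ∈ Metric.ball (0 : ℂ) ε, x ≠ 0 → φ x ≠ 0)
    (hu0 : ∀ x ∈ Metric.ball (0 : ℂ) δ, x ≠ 0 → u x ≠ 0)
    (hφδ : ∀ x ∈ Metric.ball (0 : ℂ) ε, ‖φ x ^ 2‖ < δ)
    (hf : ∀ x ∈ Metric.ball (0 : ℂ) ε, f x = u (φ x ^ 2)) :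
    ∃ (S0 : ℂ → ℂ) (R : ℝ), ContinuousOn S0 (hpl R) ∧ ∀ w ∈ hpl R, S0 w ^ 2 = f (Complex.exp w) ∧
      S0 (w + 2 * Real.pi * Complex.I) = S0 w := by
  have hE : MapsTo Complex.exp (hpl (Real.log ε)) (Metric.ball 0 ε) := fun w hw => by
    simpa using (hpl_exp hε).1 hw
  have hD : MapsTo Complex.exp (hpl (Real.log δ)) (Metric.ball 0 δ) := fun w hw => by
    simpa using (hpl_exp hδ).1 hw
  obtain ⟨l, hlc, hl⟩ := Complex.exists_continuousOn_eqOn_exp_comp (hpl_sc (Real.log ε))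
    (hpl_open _) (g := fun w => φ (Complex.exp w))
    (hφ.comp Complex.continuous_exp.continuousOn hE) (by
      rintro ⟨w, hw, h⟩
      exact hφ0 _ (hE hw) (Complex.exp_ne_zero _) h)
  obtain ⟨Q, hQc, hQ⟩ := Complex.exists_continuousOn_pow_eq (hpl_sc (Real.log δ))
    (hpl_open _) (g := fun w => u (Complex.exp w))
    (hu.comp Complex.continuous_exp.continuousOn hD) (by
      rintro ⟨w, hw, h⟩
      exact hu0 _ (hD hw) (Complex.exp_ne_zero _) h) (n := 2) two_ne_zero
  have hQ0 : ∀ {w}, w ∈ hpl (Real.log δ) → Q w ≠ 0 := fun {w} hw h => by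
    have := hQ w
    rw [h] at this
    exact hu0 _ (hD hw) (Complex.exp_ne_zero _) (by simpa using this.symm)
  have hQ2 : ∀ w ∈ hpl (Real.log δ), Q (w + 2 * (2 * Real.pi * Complex.I)) = Q w := by
    have hc : ContinuousOn (fun w => Q (w + 2 * Real.pi * Complex.I)) (hpl (Real.log δ)) :=
      hQc.comp (by fun_prop) (fun w hw => hpl_add hw)
    have e2 : ∀ w : ℂ, w + 2 * (2 * Real.pi * Complex.I)
      = (w + 2 * Real.pi * Complex.I) + 2 * Real.pi * Complex.I := fun w => by ring
    rcases (hpl_convex (Real.log δ)).isPreconnected.eq_or_eq_neg_of_sq_eq hc hQc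
      (fun w hw => by simp [hQ, exp_add_two]) hQ0 with h | h
    · intro w hw
      rw [e2]
      have h1 := h (hpl_add hw)
      have h2 := h hw
      simp only at h1 h2
      rw [h1, h2]
    · intro w hw
      rw [e2]
      have h1 := h (hpl_add hw)
      have h2 := h hw
      simp only [Pi.neg_apply] at h1 h2
      rw [h1, h2, neg_neg]
  let Q' : ℂ → ℂ := (hpl (Real.log δ)).indicator Q
  have hper : Function.Periodic Q' (2 * (2 * Real.pi * Complex.I)) := by
    intro w
    by_cases hw : w ∈ hpl (Real.log δ)
    · simp only [Q']
      rw [indicator_of_mem hw, indicator_of_mem (hpl_add_iff.2 hw), hQ2 w hw]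
    · simp only [Q']
      rw [indicator_of_notMem hw, indicator_of_notMem (fun h => hw (hpl_add_iff.1 h))]
  have hlm : ∀ w ∈ hpl (Real.log ε), 2 * l w ∈ hpl (Real.log δ) := by
    intro w hw
    have h1 : Complex.exp (l w) = φ (Complex.exp w) := hl hw
    rw [hpl_exp hδ, two_mul, Complex.exp_add, ← sq, h1]
    exact hφδ _ (hE hw)
  refine ⟨fun w => Q (2 * l w), Real.log ε, hQc.comp (by fun_prop) hlm, fun w hw => ⟨?_, ?_⟩⟩
  · have h1 : Complex.exp (l w) = φ (Complex.exp w) := hl hw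
    simp only [hQ]
    rw [two_mul, Complex.exp_add, ← sq, h1, hf _ (hE hw)]
  · have h1 : Complex.exp (l w) = φ (Complex.exp w) := hl hw
    have h2 : Complex.exp (l (w + 2 * Real.pi * Complex.I)) = φ (Complex.exp (w + 2 * Real.pi * Complex.I)) := hl (hpl_add hw)
    rw [exp_add_two, ← h1, Complex.exp_eq_exp_iff_exists_int] at h2
    obtain ⟨n, hn⟩ := h2
    have h3 : Q' (2 * l (w + 2 * Real.pi * Complex.I)) = Q' (2 * l w) := by
      rw [hn]
      have := hper.int_mul n (2 * l w)
      rw [← this]; congr 1; ring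
    simp only [Q'] at h3
    rwa [indicator_of_mem (hlm _ hw), indicator_of_mem (hlm _ (hpl_add hw))] at h3

lemma no_sqrt (r : ℂ → ℂ) (hr : Continuous r) (h : ∀ z, r z ^ 2 = z) : False := by
  have h1 := (isPreconnected_univ (α := ℂ)).eq_or_eq_neg_of_sq_eq
    (f := fun w => r (Complex.exp w)) (g := fun w => Complex.exp (w / 2))
    (by fun_prop) (by fun_prop) (fun w _ => by
      simp only [Pi.pow_apply, h]
      rw [← Complex.exp_nat_mul]; congr 1; push_cast; ring) (fun _ => Complex.exp_ne_zero _)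
  have e0 : Complex.exp (2 * Real.pi * Complex.I / 2) = -1 := by
    rw [show (2 * Real.pi * Complex.I / 2 : ℂ) = Real.pi * Complex.I by ring, Complex.exp_pi_mul_I]
  have e1 : Complex.exp (2 * Real.pi * Complex.I) = 1 := Complex.exp_two_pi_mul_I
  rcases h1 with h1 | h1
  · have a := h1 (mem_univ 0)
    have b := h1 (mem_univ (2 * Real.pi * Complex.I))
    simp only [e0, e1] at a b
    simp only [Complex.exp_zero, zero_div] at a
    rw [a] at b; norm_num at b
  · have a := h1 (mem_univ 0)
    have b := h1 (mem_univ (2 * Real.pi * Complex.I))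
    simp only [Pi.neg_apply, e0, e1] at a b
    simp only [Complex.exp_zero, zero_div] at a
    rw [a] at b; norm_num at b

lemma planar_sqrt (f : ℂ → ℂ) (hfc : Continuous f) (hfz : ∀ x, f x = 0 ↔ x = 0)
    (hloc : ∃ (S0 : ℂ → ℂ) (R : ℝ), ContinuousOn S0 (hpl R) ∧
      ∀ w ∈ hpl R, S0 w ^ 2 = f (Complex.exp w) ∧ S0 (w + 2 * Real.pi * Complex.I) = S0 w) :
    ∃ s : ℂ → ℂ, Continuous s ∧ ∀ x, s x ^ 2 = f x := by
  obtain ⟨S0, R, hS0c, hS0⟩ := hloc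
  obtain ⟨S, hSc, hS⟩ := Complex.exists_continuousOn_pow_eq univ_sc isOpen_univ
    (g := fun w => f (Complex.exp w)) (by fun_prop) (by
      rintro ⟨w, -, h⟩
      exact Complex.exp_ne_zero _ ((hfz _).1 h)) (n := 2) two_ne_zero
  rw [continuousOn_univ] at hSc
  have hSne : ∀ w, S w ≠ 0 := fun w h => by
    have := hS w
    rw [h] at this
    exact Complex.exp_ne_zero w ((hfz _).1 (by simpa using this.symm))
  have hS0ne : ∀ {w}, w ∈ hpl R → S0 w ≠ 0 := fun {w} hw h => by
    have := (hS0 w hw).1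
    rw [h] at this
    exact Complex.exp_ne_zero w ((hfz _).1 (by simpa using this.symm))
  obtain ⟨w0, hw0⟩ := hpl_nonempty R
  have hp0 : S (w0 + 2 * Real.pi * Complex.I) = S w0 := by
    rcases (hpl_convex R).isPreconnected.eq_or_eq_neg_of_sq_eq hSc.continuousOn hS0c
      (fun w hw => by simp [hS, (hS0 w hw).1]) hS0ne with h | h
    · rw [h hw0, h (hpl_add hw0), (hS0 w0 hw0).2]
    · rw [h hw0, h (hpl_add hw0)]
      simp [(hS0 w0 hw0).2]
  have hper : Function.Periodic S (2 * Real.pi * Complex.I) := by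
    rcases (isPreconnected_univ (α := ℂ)).eq_or_eq_neg_of_sq_eq
      (f := fun w => S (w + 2 * Real.pi * Complex.I)) (g := S) (by fun_prop) hSc.continuousOn
      (fun w hw => by simp [hS, exp_add_two]) (fun _ => hSne _) with h | h
    · exact fun w => h (mem_univ w)
    · exfalso
      have := h (mem_univ w0)
      simp only [Pi.neg_apply, hp0] at this
      exact hSne w0 (self_eq_neg.1 this)
  let s : ℂ → ℂ := fun x => if x = 0 then 0 else S (Complex.log x)
  have hsq : ∀ x, s x ^ 2 = f x := by
    intro x
    by_cases hx : x = 0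
    · simp [s, hx, (hfz 0).2 rfl]
    · simp [s, hx, hS, Complex.exp_log hx]
  have hse : ∀ w, s (Complex.exp w) = S w := by
    intro w
    simp only [s, Complex.exp_ne_zero, if_false]
    obtain ⟨n, hn⟩ := Complex.exp_eq_exp_iff_exists_int.1
      (Complex.exp_log (Complex.exp_ne_zero w))
    rw [hn]
    exact hper.int_mul n w
  refine ⟨s, continuous_iff_continuousAt.2 fun x => ?_, hsq⟩
  by_cases hx : x = 0
  · subst hx
    have hs0 : s 0 = 0 := by simp [s]
    rw [ContinuousAt, hs0, tendsto_zero_iff_norm_tendsto_zero]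
    have h1 : ∀ x, ‖s x‖ = Real.sqrt ‖f x‖ := fun x => by
      rw [← hsq, norm_pow, Real.sqrt_sq (norm_nonneg _)]
    simp only [h1]
    have h2 : Continuous fun x => Real.sqrt ‖f x‖ := by fun_prop
    have := h2.tendsto 0
    simpa [(hfz 0).2 rfl] using this
  · rw [← Complex.exp_log hx, ContinuousAt,
      ← (Complex.hasStrictDerivAt_exp (Complex.log x)).map_nhds_eq (Complex.exp_ne_zero _),
      tendsto_map'_iff, hse]
    have : s ∘ Complex.exp = S := funext hse
    rw [this]
    exact hSc.tendsto _

lemma planar_homeo (f : ℂ → ℂ) (hfc : Continuous f)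
    (hfp : Tendsto f (cocompact ℂ) (cocompact ℂ)) (hfo : IsOpenMap f)
    (hfs : Function.Surjective f) (hfz : ∀ x, f x = 0 ↔ x = 0)
    (hf2 : ∀ x y z, f x = f y → f x = f z → x = y ∨ x = z ∨ y = z)
    (hloc : ∃ (S0 : ℂ → ℂ) (R : ℝ), ContinuousOn S0 (hpl R) ∧
      ∀ w ∈ hpl R, S0 w ^ 2 = f (Complex.exp w) ∧ S0 (w + 2 * Real.pi * Complex.I) = S0 w) :
    ∃ s : ℂ ≃ₜ ℂ, ∀ x, s x ^ 2 = f x := by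
  obtain ⟨s, hsc, hs⟩ := planar_sqrt f hfc hfz hloc
  have hsz : ∀ x, s x = 0 ↔ x = 0 := fun x => by
    rw [← hfz x, ← hs x, sq_eq_zero_iff]
  have hsp : IsProperMap s := by
    rw [isProperMap_iff_tendsto_cocompact]
    refine ⟨hsc, ?_⟩
    rw [← Metric.cobounded_eq_cocompact, ← tendsto_norm_atTop_iff_cobounded] at hfp ⊢
    have h1 : ∀ x, ‖s x‖ = Real.sqrt ‖f x‖ := fun x => by
      rw [← hs, norm_pow, Real.sqrt_sq (norm_nonneg _)]
    simp only [h1]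
    exact Real.tendsto_sqrt_atTop.comp hfp
  have hcl : IsClosedMap s := hsp.isClosedMap
  let B : Set ℂ := {x | ∃ y, s y = - s x}
  have hBc : IsClosed B := hcl.isClosed_range.preimage hsc.neg
  have hBo : IsOpen (B ∩ {0}ᶜ) := by
    rw [isOpen_iff_mem_nhds]
    rintro x ⟨⟨y, hy⟩, hx⟩
    have hx : x ≠ 0 := hx
    have hsx : 0 < ‖s x‖ := norm_pos_iff.2 (fun h => hx ((hsz x).1 h))
    have hN : {x' | ‖s x' - s x‖ < ‖s x‖} ∈ 𝓝 x :=
      (isOpen_lt (by fun_prop) (by fun_prop)).mem_nhds (by simpa using hsx)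
    have hM : {y' | ‖s y' - s y‖ < ‖s x‖} ∈ 𝓝 y :=
      (isOpen_lt (by fun_prop) (by fun_prop)).mem_nhds (by simpa using hsx)
    have hxy : f y = f x := by rw [← hs, ← hs, hy, neg_sq]
    have hM' : f ⁻¹' (f '' {y' | ‖s y' - s y‖ < ‖s x‖}) ∈ 𝓝 x :=
      hfc.continuousAt.preimage_mem_nhds (hxy ▸ hfo.image_mem_nhds hM)
    filter_upwards [hN, hM', isOpen_ne.mem_nhds hx] with x' h1 h2 h3
    refine ⟨?_, h3⟩
    obtain ⟨y', h4, h5⟩ := h2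
    refine ⟨y', ?_⟩
    rw [← hs, ← hs] at h5
    rcases sq_eq_sq_iff_eq_or_eq_neg.1 h5 with h | h
    · exfalso
      simp only [mem_ofPred_eq] at h1 h4
      rw [h, hy] at h4
      have : ‖(2 : ℂ) * s x‖ < ‖s x‖ + ‖s x‖ := by
        calc ‖(2 : ℂ) * s x‖ = ‖(s x' - - s x) - (s x' - s x)‖ := by congr 1; ring
          _ ≤ _ := norm_sub_le _ _
          _ < _ := add_lt_add h4 h1
      rw [norm_mul] at this
      norm_num at this
      linarith
    · exact h
  have hconn : IsPreconnected ({0}ᶜ : Set ℂ) :=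
    (isConnected_compl_singleton_of_one_lt_rank (by simp) 0).isPreconnected
  have hAo : IsOpen (Bᶜ ∩ {0}ᶜ : Set ℂ) := hBc.isOpen_compl.inter isOpen_compl_singleton
  have hB : ∀ x, x ≠ 0 → x ∈ B := by
    by_contra! hne
    obtain ⟨x0, hx0, hx0B⟩ := hne
    have hsub := hconn.subset_left_of_subset_union hAo hBo
      (by rw [Set.disjoint_left]; rintro x ⟨h, _⟩ ⟨h', _⟩; exact h h')
      (fun x hx => by
        by_cases h : x ∈ B
        · exact Or.inr ⟨h, hx⟩
        · exact Or.inl ⟨h, hx⟩) ⟨x0, hx0, hx0B, hx0⟩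
    have hconst : ∀ x y, f x = f y → s x = s y := by
      intro x y hxy
      by_cases hx : x = 0
      · have : y = 0 := by rw [← hfz, ← hxy, hfz, hx]
        rw [hx, this]
      · rw [← hs, ← hs] at hxy
        rcases sq_eq_sq_iff_eq_or_eq_neg.1 hxy with h | h
        · exact h
        · exact absurd ⟨y, by rw [h, neg_neg]⟩ (hsub (show x ∈ ({0}ᶜ : Set ℂ) from hx)).1
    have hq : Topology.IsQuotientMap f := hfo.isQuotientMap hfc hfs
    let r : ℂ → ℂ := fun y => s (Function.surjInv hfs y)
    have hrf : r ∘ f = s := funext fun x => hconst _ _ (Function.surjInv_eq hfs (f x))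
    refine no_sqrt r (hq.continuous_iff.2 (hrf ▸ hsc)) fun z => ?_
    simp only [r]
    rw [hs, Function.surjInv_eq hfs]
  have hinj : Function.Injective s := by
    intro x y hxy
    by_contra hne
    have hx : x ≠ 0 := by
      rintro rfl
      exact hne ((hsz y).1 (hxy ▸ (hsz 0).2 rfl)).symm
    obtain ⟨z, hz⟩ := hB x hx
    have hsx : s x ≠ 0 := fun h => hx ((hsz x).1 h)
    rcases hf2 x y z (by rw [← hs, ← hs, hxy]) (by rw [← hs, ← hs, hz, neg_sq]) with h | h | h
    · exact hne h
    · rw [← h] at hz; exact hsx (self_eq_neg.1 hz)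
    · rw [← h, ← hxy] at hz; exact hsx (self_eq_neg.1 hz)
  have hsurj : Function.Surjective s := by
    intro z
    obtain ⟨x, hx⟩ := hfs (z ^ 2)
    rw [← hs] at hx
    rcases sq_eq_sq_iff_eq_or_eq_neg.1 hx with h | h
    · exact ⟨x, h⟩
    · by_cases hz : z = 0
      · exact ⟨x, by simp [h, hz]⟩
      · obtain ⟨y, hy⟩ := hB x (fun h0 => hz (by rw [(hsz x).2 h0] at h; simpa using h.symm))
        exact ⟨y, by rw [hy, h, neg_neg]⟩
  exact ⟨(Equiv.ofBijective s ⟨hinj, hsurj⟩).toHomeomorphOfContinuousClosed hsc hcl, hs⟩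

lemma local_roots {F : Sph → Sph} {x : Sph} {k : ℕ} (h : IsRamifiedAt F x k) {N : Set Sph}
    (hN : N ∈ 𝓝 x) : ∃ O ∈ 𝓝 (F x), ∀ y ∈ O, y ≠ F x →
      ∃ a : ℕ → Sph, (∀ i, a i ∈ N ∧ F (a i) = y) ∧ InjOn a (Iio k) := by
  obtain ⟨hk, U, V, hx, hfx, hmap, hU, hV, φ, ψ, hφ0, hψ0, hφψ⟩ := h
  have h0 : (0 : ℂ) ∈ unitDisk := by simp [unitDisk]
  let g : unitDisk → Sph := fun z => (φ.symm z : Sph)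
  have hg : Continuous g := by fun_prop
  have hg0 : g ⟨0, h0⟩ = x := by
    have : φ.symm ⟨0, h0⟩ = ⟨x, hx⟩ := by
      rw [Homeomorph.symm_apply_eq]; exact Subtype.ext hφ0.symm
    simp only [g, this]
  have hgi : Function.Injective g := fun a b hab => φ.symm.injective (Subtype.ext hab)
  have hgN : g ⁻¹' N ∈ 𝓝 (⟨0, h0⟩ : unitDisk) :=
    hg.continuousAt.preimage_mem_nhds (by rw [hg0]; exact hN)
  obtain ⟨ρ, hρ, hb⟩ := Metric.mem_nhds_iff.1 hgN
  refine ⟨Subtype.val '' {y : V | ‖(ψ y : ℂ)‖ < ρ ^ k}, ?_, ?_⟩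
  · apply IsOpen.mem_nhds
    · exact hV.isOpenMap_subtype_val _ (isOpen_lt (by fun_prop) (by fun_prop))
    · exact ⟨⟨F x, hfx⟩, by simp [hψ0, hρ], rfl⟩
  · rintro _ ⟨y, hy, rfl⟩ hne
    obtain ⟨z, hz⟩ := IsAlgClosed.exists_pow_nat_eq (ψ y : ℂ) hk
    have hw0 : (ψ y : ℂ) ≠ 0 := fun h => hne (by
      have : y = ⟨F x, hfx⟩ := ψ.injective (Subtype.ext (h.trans hψ0.symm))
      rw [this])
    have hz0 : z ≠ 0 := fun h => hw0 (by rw [← hz, h, zero_pow hk.ne'])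
    have hζ := Complex.isPrimitiveRoot_exp k hk.ne'
    set ζ := Complex.exp (2 * Real.pi * Complex.I / k)
    have hζn : ‖ζ‖ = 1 := hζ.norm'_eq_one hk.ne'
    have hnz : ∀ i : ℕ, ‖ζ ^ i * z‖ = ‖z‖ := fun i => by simp [hζn]
    have hz1 : ‖z‖ < 1 := by
      have h1 : ‖(ψ y : ℂ)‖ < 1 := mem_ball_zero_iff.1 (ψ y).2
      rw [← hz, norm_pow] at h1
      exact lt_of_pow_lt_pow_left₀ k zero_le_one (by simpa using h1)
    have hzρ : ‖z‖ < ρ := by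
      have h1 : ‖(ψ y : ℂ)‖ < ρ ^ k := hy
      rw [← hz, norm_pow] at h1
      exact lt_of_pow_lt_pow_left₀ k hρ.le h1
    have hmem : ∀ i : ℕ, ζ ^ i * z ∈ unitDisk := fun i => by
      simpa [unitDisk, hζn] using hz1
    refine ⟨fun i => g ⟨ζ ^ i * z, hmem i⟩, fun i => ⟨hb ?_, ?_⟩, ?_⟩
    · simpa [Subtype.dist_eq, hζn] using hzρ
    · have h1 := hφψ (φ.symm ⟨ζ ^ i * z, hmem i⟩)
      rw [Homeomorph.apply_symm_apply] at h1
      have h2 : (ζ ^ i * z) ^ k = (ψ y : ℂ) := by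
        rw [mul_pow, ← pow_mul, mul_comm i k, pow_mul, hζ.pow_eq_one, one_pow, one_mul, hz]
      rw [h2] at h1
      exact congrArg Subtype.val (ψ.injective (Subtype.ext h1))
    · intro i hi j hj hij
      have h1 := congrArg Subtype.val (hgi hij)
      exact hζ.pow_inj hi hj (mul_right_cancel₀ hz0 h1)

lemma rc_open {F : Sph → Sph} (hF : IsRamifiedCovering F) : IsOpenMap F := by
  refine IsOpenMap.of_nhds_le fun x T hT => ?_
  obtain ⟨k, hk⟩ := hF.2 x
  obtain ⟨O, hO, h⟩ := local_roots hk (N := F ⁻¹' T) hT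
  filter_upwards [hO] with y hy
  by_cases hyx : y = F x
  · rw [hyx]; exact mem_of_mem_nhds (x := x) hT
  · obtain ⟨a, ha, -⟩ := h y hy hyx
    rw [← (ha 0).2]; exact (ha 0).1

lemma exists_coord0 (p : Sph) : ∃ α : OnePoint ℂ ≃ₜ Sph, α OnePoint.infty = p := by
  have hv : ‖(p : EuclideanSpace ℝ (Fin 3))‖ = 1 := by simp
  have hv₀ : (p : EuclideanSpace ℝ (Fin 3)) ≠ 0 := fun h => by simp [h] at hv
  have : Fact (Module.finrank ℝ (EuclideanSpace ℝ (Fin 3)) = 2 + 1) := ⟨by simp⟩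
  have hV : Module.finrank ℝ ℂ = Module.finrank ℝ (ℝ ∙ (p : EuclideanSpace ℝ (Fin 3)))ᗮ := by
    rw [Submodule.finrank_orthogonal_span_singleton (n := 2) hv₀]; simp
  let e : ℂ ≃ₜ (ℝ ∙ (p : EuclideanSpace ℝ (Fin 3)))ᗮ :=
    (FiniteDimensional.nonempty_continuousLinearEquiv_of_finrank_eq hV).some.toHomeomorph
  exact ⟨e.onePointCongr.trans (onePointHyperplaneHomeoUnitSphere hv), rfl⟩

lemma exists_coord (p q : Sph) (h : p ≠ q) :
    ∃ α : OnePoint ℂ ≃ₜ Sph, α OnePoint.infty = p ∧ α ((0 : ℂ) : OnePoint ℂ) = q := by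
  obtain ⟨α, hα⟩ := exists_coord0 p
  have : α.symm q ≠ OnePoint.infty := fun h' => h (by rw [← hα, ← h', Homeomorph.apply_symm_apply])
  obtain ⟨z, hz⟩ := OnePoint.ne_infty_iff_exists.1 this
  refine ⟨(Homeomorph.addLeft z).onePointCongr.trans α, hα, ?_⟩
  simp [hz]

lemma sph_conn_compl (s : Set Sph) (hs : s.Finite) (hne : s.Nonempty) : IsPreconnected sᶜ := by
  obtain ⟨p, hp⟩ := hne
  obtain ⟨α, hα⟩ := exists_coord0 p
  have h1 : ((fun z : ℂ => α (z : OnePoint ℂ)) ⁻¹' s).Finite :=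
    hs.preimage ((α.injective.comp OnePoint.coe_injective).injOn)
  have h2 := (h1.countable.isConnected_compl_of_one_lt_rank (by simp)).isPreconnected
  have h3 := h2.image (fun z : ℂ => α (z : OnePoint ℂ))
    (α.continuous.comp OnePoint.continuous_coe).continuousOn
  convert h3 using 1
  ext y
  constructor
  · intro hy
    have : α.symm y ≠ OnePoint.infty := fun h' => hy (by
      rw [← α.apply_symm_apply y, h', hα]; exact hp)
    obtain ⟨z, hz⟩ := OnePoint.ne_infty_iff_exists.1 this
    exact ⟨z, by simpa [hz] using hy, by simp [hz]⟩
  · rintro ⟨z, hz, rfl⟩; exact hz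

lemma sph_pt : Nonempty Sph :=
  ⟨⟨EuclideanSpace.single 0 1, by simp⟩⟩

instance sph_conn : PreconnectedSpace Sph := by
  obtain ⟨p⟩ := sph_pt
  obtain ⟨α, hα⟩ := exists_coord0 p
  exact ⟨by rw [← α.surjective.range_eq]; exact isPreconnected_range α.continuous⟩

lemma sph_inf {p : Sph} {s : Set Sph} (hs : s ∈ 𝓝 p) : s.Infinite := by
  obtain ⟨α, hα⟩ := exists_coord0 p
  have h1 : α ⁻¹' s ∈ 𝓝 (OnePoint.infty : OnePoint ℂ) :=
    α.continuous.continuousAt.preimage_mem_nhds (by rw [hα]; exact hs)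
  have h2 := infinite_of_mem_nhds _ h1
  exact fun hfin => h2 (hfin.preimage α.injective.injOn)

lemma rc_surj {F : Sph → Sph} (hF : IsRamifiedCovering F) : Function.Surjective F := by
  have h1 : IsClopen (range F) := ⟨(isCompact_range hF.1).isClosed, (rc_open hF).isOpen_range⟩
  obtain ⟨p⟩ := sph_pt
  exact range_eq_univ.1 (h1.eq_univ ⟨F p, mem_range_self p⟩)

lemma cv_finite {F : Sph → Sph} (hF : IsThurstonMap F) : {y | IsCriticalValue F y}.Finite := by
  refine hF.2.subset ?_
  rintro y ⟨x, hx, rfl⟩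
  simp only [postCritical, mem_iUnion]
  exact ⟨1, le_refl 1, x, hx, rfl⟩

lemma cv_mem {F : Sph → Sph} {c : Sph} (hc : IsCriticalPt F c) : F c ∈ postCritical F := by
  simp only [postCritical, mem_iUnion]
  exact ⟨1, le_refl 1, c, hc, rfl⟩

lemma fib_two {F : Sph → Sph} (hd : HasDegreeTwo F) {y : Sph} (hy : ¬IsCriticalValue F y) :
    ∃ a b, a ≠ b ∧ F ⁻¹' {y} = {a, b} := by
  have := hd y hy
  exact Set.ncard_eq_two.1 this

lemma crit_fiber {F : Sph → Sph} (hF : IsThurstonMap F) (hd : HasDegreeTwo F) {c x : Sph}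
    (hc : IsCriticalPt F c) (hx : F x = F c) : x = c := by
  by_contra hne
  obtain ⟨k, hk2, hk⟩ := hc
  obtain ⟨A, B, hA, hB, hxA, hcB, hAB⟩ := t2_separation hne
  obtain ⟨O, hO, h⟩ := local_roots hk (hB.mem_nhds hcB)
  have h2 : F '' A ∈ 𝓝 (F c) := hx ▸ (rc_open hF.1).image_mem_nhds (hA.mem_nhds hxA)
  obtain ⟨y, ⟨hyO, x', hx'A, hx'⟩, hy⟩ :=
    ((sph_inf (inter_mem hO h2)).sdiff (cv_finite hF)).nonempty
  have hyc : y ≠ F c := fun h => hy ⟨c, ⟨k, hk2, hk⟩, h.symm⟩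
  obtain ⟨a, ha, hai⟩ := h y hyO hyc
  obtain ⟨p, q, hpq, hfib⟩ := fib_two hd hy
  have m0 : a 0 ∈ F ⁻¹' {y} := (ha 0).2
  have m1 : a 1 ∈ F ⁻¹' {y} := (ha 1).2
  have m2 : x' ∈ F ⁻¹' {y} := hx'
  have n01 : a 0 ≠ a 1 := fun h => by
    have := hai (show 0 ∈ Iio k by simp; omega) (show 1 ∈ Iio k by simp; omega) h
    omega
  have n0 : x' ≠ a 0 := fun h => Set.disjoint_left.1 hAB hx'A (h ▸ (ha 0).1)
  have n1 : x' ≠ a 1 := fun h => Set.disjoint_left.1 hAB hx'A (h ▸ (ha 1).1)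
  rw [hfib] at m0 m1 m2
  simp only [mem_insert_iff, mem_singleton_iff] at m0 m1 m2
  grind

lemma fib_le_two {F : Sph → Sph} (hF : IsThurstonMap F) (hd : HasDegreeTwo F) (x y z : Sph)
    (h1 : F x = F y) (h2 : F x = F z) : x = y ∨ x = z ∨ y = z := by
  by_cases h : IsCriticalValue F (F x)
  · obtain ⟨c, hc, hcx⟩ := h
    have hx := crit_fiber hF hd hc hcx.symm
    have hy : y = c := crit_fiber hF hd hc (h1.symm.trans hcx.symm)
    left; rw [hx, hy]
  · obtain ⟨p, q, hpq, hfib⟩ := fib_two hd h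
    have m0 : x ∈ F ⁻¹' {F x} := rfl
    have m1 : y ∈ F ⁻¹' {F x} := h1.symm
    have m2 : z ∈ F ⁻¹' {F x} := h2.symm
    rw [hfib] at m0 m1 m2
    simp only [mem_insert_iff, mem_singleton_iff] at m0 m1 m2
    grind

lemma ram_two {F : Sph → Sph} (hF : IsThurstonMap F) (hd : HasDegreeTwo F) {c : Sph}
    (hc : IsCriticalPt F c) : IsRamifiedAt F c 2 := by
  obtain ⟨k, hk2, hk⟩ := hc
  obtain ⟨O, hO, h⟩ := local_roots hk univ_mem
  obtain ⟨y, hyO, hy⟩ := ((sph_inf hO).sdiff (finite_singleton (F c))).nonempty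
  obtain ⟨a, ha, hai⟩ := h y hyO hy
  have : k = 2 := by
    by_contra hne
    have i0 : 0 ∈ Iio k := by simp; omega
    have i1 : 1 ∈ Iio k := by simp; omega
    have i2 : 2 ∈ Iio k := by simp; omega
    rcases fib_le_two hF hd (a 0) (a 1) (a 2) ((ha 0).2.trans (ha 1).2.symm)
      ((ha 0).2.trans (ha 2).2.symm) with h | h | h
    · have := hai i0 i1 h; omega
    · have := hai i0 i2 h; omega
    · have := hai i1 i2 h; omega
  exact this ▸ hk

lemma loc_homeo {F : Sph → Sph} (hF : IsRamifiedCovering F) {x : Sph} (hx : ¬ IsCriticalPt F x) :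
    ∃ U ∈ 𝓝 x, Topology.IsOpenEmbedding (U.domRestrict F) := by
  obtain ⟨k, hk⟩ := hF.2 x
  have h1 : k = 1 := by
    by_contra hne
    exact hx ⟨k, by have := hk.1; omega, hk⟩
  subst h1
  obtain ⟨-, U, V, hxU, hfx, hmap, hU, hV, φ, ψ, hφ0, hψ0, hφψ⟩ := hk
  refine ⟨U, hU.mem_nhds hxU, .of_continuous_injective_isOpenMap ?_ ?_ ?_⟩
  · exact hF.1.comp continuous_subtype_val
  · intro a b hab
    have hab : F a = F b := hab
    apply φ.injective
    apply Subtype.ext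
    rw [← pow_one (φ a : ℂ), ← pow_one (φ b : ℂ), ← hφψ, ← hφψ]
    simp only [hab]
  · exact (rc_open hF).comp hU.isOpenMap_subtype_val

lemma exists_two_crit {F : Sph → Sph} (hF : IsThurstonMap F) (hd : HasDegreeTwo F) :
    ∃ c d, IsCriticalPt F c ∧ IsCriticalPt F d ∧ c ≠ d := by
  by_contra! hcon
  obtain ⟨v, hv⟩ : ∃ v, ∀ c, IsCriticalPt F c → F c = v := by
    by_cases h : ∃ c, IsCriticalPt F c
    · obtain ⟨c, hc⟩ := h
      exact ⟨F c, fun d hd' => by rw [hcon c d hc hd']⟩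
    · obtain ⟨p⟩ := sph_pt
      exact ⟨p, fun c hc => absurd ⟨c, hc⟩ h⟩
  have hcv : ∀ y, y ≠ v → ¬ IsCriticalValue F y := by
    rintro y hy ⟨c, hc, rfl⟩; exact hy (hv c hc)
  have hcov : IsCoveringMapOn F {v}ᶜ := by
    apply IsCoveringMapOn.of_isLocalHomeomorphOn hF.1.1
    rw [isLocalHomeomorphOn_iff_isOpenEmbedding_restrict]
    intro x hx
    exact loc_homeo hF.1 fun hc => hx (hv x hc)
  obtain ⟨α, hα⟩ := exists_coord0 v
  let A : C(ℂ, Sph) := ⟨fun z => α (z : OnePoint ℂ), α.continuous.comp OnePoint.continuous_coe⟩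
  have hA : ∀ z, A z ∈ ({v}ᶜ : Set Sph) := fun z h => by
    have h : α (z : OnePoint ℂ) = v := h
    rw [← hα] at h
    exact OnePoint.coe_ne_infty z (α.injective h)
  obtain ⟨a, b, hab, hfib⟩ := fib_two hd (hcv _ (hA 0))
  have ha : F a = A 0 := by
    have : a ∈ F ⁻¹' {A 0} := by rw [hfib]; simp
    exact this
  have hb : F b = A 0 := by
    have : b ∈ F ⁻¹' {A 0} := by rw [hfib]; simp
    exact this
  obtain ⟨σ, ⟨hσ0, hσ⟩, -⟩ := hcov.existsUnique_continuousMap_lifts A ha hA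
  obtain ⟨τ, ⟨hτ0, hτ⟩, -⟩ := hcov.existsUnique_continuousMap_lifts A hb hA
  have hσ' : ∀ z, F (σ z) = A z := fun z => congrFun hσ z
  have hτ' : ∀ z, F (τ z) = A z := fun z => congrFun hτ z
  have hdis : ∀ z, σ z ≠ τ z := by
    intro z hz
    obtain ⟨ρ, -, hu⟩ := hcov.existsUnique_continuousMap_lifts A (hσ' z) hA
    have h1 := hu σ ⟨rfl, hσ⟩
    have h2 := hu τ ⟨hz.symm, hτ⟩
    exact hab (by rw [← hσ0, ← hτ0, h1, h2])
  have hfin : (F ⁻¹' {v}).Finite := by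
    by_cases h : IsCriticalValue F v
    · obtain ⟨c, hc, hcv⟩ := h
      exact (finite_singleton c).subset fun x hx => crit_fiber hF hd hc (by rw [hcv]; exact hx)
    · obtain ⟨p, q, -, h⟩ := fib_two hd h
      rw [h]; exact toFinite _
  obtain ⟨p, hp⟩ := rc_surj hF.1 v
  have hconn := sph_conn_compl (F ⁻¹' {v}) hfin ⟨p, hp⟩
  -- partial inverse of A
  have hX : ∀ x ∈ (F ⁻¹' {v})ᶜ, ∃ z : ℂ, A z = F x := by
    intro x hx
    have : α.symm (F x) ≠ OnePoint.infty := fun h' => hx (by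
      show F x = v
      rw [← hα, ← h', Homeomorph.apply_symm_apply])
    obtain ⟨z, hz⟩ := OnePoint.ne_infty_iff_exists.1 this
    exact ⟨z, by simp [A, hz]⟩
  have hAo : IsOpenMap A := α.isOpenMap.comp OnePoint.isOpenMap_coe
  have hAi : Function.Injective A := α.injective.comp OnePoint.coe_injective
  have hσo : IsOpen (range σ) := by
    rw [isOpen_iff_mem_nhds]
    rintro _ ⟨z, rfl⟩
    -- near σ z, F is injective
    obtain ⟨W, hW, hWe⟩ := loc_homeo hF.1 (x := σ z) (fun hc => hA z (by
      rw [← hσ' z]; exact hv _ hc))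
    have h1 : A '' (σ ⁻¹' W) ∈ 𝓝 (F (σ z)) := by
      rw [hσ']
      exact hAo.image_mem_nhds (σ.continuous.continuousAt.preimage_mem_nhds hW)
    filter_upwards [hW, hF.1.1.continuousAt.preimage_mem_nhds h1] with x hxW hx
    obtain ⟨z', hz', hz''⟩ := hx
    refine ⟨z', ?_⟩
    have := hWe.injective (a₁ := ⟨σ z', hz'⟩) (a₂ := ⟨x, hxW⟩) (by
      show F (σ z') = F x
      rw [hσ', hz''])
    exact congrArg Subtype.val this
  have hτo : IsOpen (range τ) := by
    rw [isOpen_iff_mem_nhds]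
    rintro _ ⟨z, rfl⟩
    obtain ⟨W, hW, hWe⟩ := loc_homeo hF.1 (x := τ z) (fun hc => hA z (by
      rw [← hτ' z]; exact hv _ hc))
    have h1 : A '' (τ ⁻¹' W) ∈ 𝓝 (F (τ z)) := by
      rw [hτ']
      exact hAo.image_mem_nhds (τ.continuous.continuousAt.preimage_mem_nhds hW)
    filter_upwards [hW, hF.1.1.continuousAt.preimage_mem_nhds h1] with x hxW hx
    obtain ⟨z', hz', hz''⟩ := hx
    refine ⟨z', ?_⟩
    have := hWe.injective (a₁ := ⟨τ z', hz'⟩) (a₂ := ⟨x, hxW⟩) (by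
      show F (τ z') = F x
      rw [hτ', hz''])
    exact congrArg Subtype.val this
  have hdisj : Disjoint (range σ) (range τ) := by
    rw [Set.disjoint_left]
    rintro _ ⟨z, rfl⟩ ⟨z', h⟩
    have : z' = z := hAi (by rw [← hτ' z', ← hσ' z, h])
    subst this
    exact hdis z' h.symm
  have hsub := hconn.subset_left_of_subset_union hσo hτo hdisj (by
      intro x hx
      obtain ⟨z, hz⟩ := hX x hx
      rcases fib_le_two hF hd x (σ z) (τ z) (by rw [hσ', hz]) (by rw [hτ', hz]) with h | h | h
      · exact Or.inl ⟨z, h.symm⟩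
      · exact Or.inr ⟨z, h.symm⟩
      · exact absurd h (hdis z))
    ⟨σ 0, (show σ 0 ∈ (F ⁻¹' {v})ᶜ from fun h => hA 0 (by rw [← hσ' 0]; exact h)), mem_range_self 0⟩
  exact Set.disjoint_left.1 hdisj
    (hsub (show τ 0 ∈ (F ⁻¹' {v})ᶜ from fun h => hA 0 (by rw [← hτ' 0]; exact h)))
    (mem_range_self 0)


def toC : OnePoint ℂ → ℂ := fun w => w.elim 0 id

lemma toC_coe (z : ℂ) : toC (z : OnePoint ℂ) = z := rfl

lemma coe_toC {w : OnePoint ℂ} (h : w ≠ OnePoint.infty) : ((toC w : ℂ) : OnePoint ℂ) = w := by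
  obtain ⟨z, rfl⟩ := OnePoint.ne_infty_iff_exists.1 h
  rfl

lemma toC_cont {w : OnePoint ℂ} (h : w ≠ OnePoint.infty) : ContinuousAt toC w := by
  obtain ⟨z, rfl⟩ := OnePoint.ne_infty_iff_exists.1 h
  rw [OnePoint.continuousAt_coe]
  exact continuousAt_id (x := z)

lemma cont_toC {X : Type*} [TopologicalSpace X] {f : X → OnePoint ℂ} (hf : Continuous f)
    (h : ∀ x, f x ≠ OnePoint.infty) : Continuous (fun x => toC (f x)) :=
  continuous_iff_continuousAt.2 fun x => (toC_cont (h x)).comp hf.continuousAt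

lemma ext_cont {U : Set Sph} (φ : U → ℂ) (hφ : Continuous φ) (g : ℂ → Sph)
    (hg : Continuous g) : ∃ φ' : ℂ → ℂ, ContinuousOn φ' (g ⁻¹' U) ∧
      ∀ x (h : g x ∈ U), φ' x = φ ⟨g x, h⟩ := by
  classical
  refine ⟨fun x => if h : g x ∈ U then φ ⟨g x, h⟩ else 0, ?_, fun x h => by simp [h]⟩
  rw [continuousOn_iff_continuous_domRestrict]
  have : (g ⁻¹' U).domRestrict (fun x => if h : g x ∈ U then φ ⟨g x, h⟩ else 0) =
      fun x : (g ⁻¹' U : Set ℂ) => φ ⟨g x, x.2⟩ := by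
    ext x
    have : g x ∈ U := x.2
    simp [Set.domRestrict, this]
  rw [this]
  exact hφ.comp (by fun_prop)

lemma chart_hloc {F : Sph → Sph} {c : Sph} (hc : IsRamifiedAt F c 2)
    (α γ : OnePoint ℂ ≃ₜ Sph) (hα : α ((0 : ℂ) : OnePoint ℂ) = F c)
    (hγ : γ ((0 : ℂ) : OnePoint ℂ) = c) (f : ℂ → ℂ)
    (hf : ∀ x : ℂ, F (γ (x : OnePoint ℂ)) = α (f x : OnePoint ℂ)) :
    ∃ (S0 : ℂ → ℂ) (R : ℝ), ContinuousOn S0 (hpl R) ∧ ∀ w ∈ hpl R, S0 w ^ 2 = f (Complex.exp w) ∧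
      S0 (w + 2 * Real.pi * Complex.I) = S0 w := by
  classical
  obtain ⟨-, U, V, hx, hfx, hmap, hU, hV, φ, ψ, hφ0, hψ0, hφψ⟩ := hc
  have h0 : (0 : ℂ) ∈ unitDisk := by simp [unitDisk]
  have hdo : IsOpen unitDisk := Metric.isOpen_ball
  have hgc : Continuous fun x : ℂ => γ (x : OnePoint ℂ) :=
    γ.continuous.comp OnePoint.continuous_coe
  obtain ⟨φ', hφ'c, hφ'⟩ := ext_cont (fun x => (φ x : ℂ)) (by fun_prop)
    (fun x : ℂ => γ (x : OnePoint ℂ)) hgc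
  let u : ℂ → ℂ := fun z => if h : z ∈ unitDisk then toC (α.symm (ψ.symm ⟨z, h⟩ : Sph)) else 0
  have hψs0 : ψ.symm ⟨0, h0⟩ = ⟨F c, hfx⟩ := by
    rw [Homeomorph.symm_apply_eq]; exact Subtype.ext hψ0.symm
  let m : unitDisk → OnePoint ℂ := fun z => α.symm (ψ.symm z : Sph)
  have hm : Continuous m := by fun_prop
  have hm0 : m ⟨0, h0⟩ = ((0 : ℂ) : OnePoint ℂ) := by
    simp only [m, hψs0, ← hα, Homeomorph.symm_apply_apply]
  have hD : IsOpen {z : unitDisk | m z ≠ OnePoint.infty} := isOpen_ne_fun hm continuous_const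
  have hD' : Subtype.val '' {z : unitDisk | m z ≠ OnePoint.infty} ∈ 𝓝 (0 : ℂ) :=
    (hdo.isOpenMap_subtype_val _ hD).mem_nhds ⟨⟨0, h0⟩, by simp [hm0], rfl⟩
  obtain ⟨δ, hδ, hδb⟩ := Metric.mem_nhds_iff.1 hD'
  have hW : (fun x : ℂ => γ (x : OnePoint ℂ)) ⁻¹' U ∈ 𝓝 (0 : ℂ) :=
    (hU.preimage hgc).mem_nhds (by simpa [hγ] using hx)
  have hφ'0 : φ' 0 = 0 := by
    rw [hφ' 0 (by simpa [hγ] using hx)]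
    simpa [hγ] using hφ0
  have hφ'at : ContinuousAt (fun x => ‖φ' x ^ 2‖) 0 :=
    ((hφ'c.continuousAt hW).pow 2).norm
  have hlt : ∀ᶠ x in 𝓝 (0 : ℂ), ‖φ' x ^ 2‖ < δ :=
    hφ'at.eventually_lt continuousAt_const (by simpa [hφ'0] using hδ)
  obtain ⟨ε, hε, hεb⟩ := Metric.eventually_nhds_iff_ball.1 (hlt.and hW)
  have hum : ∀ z : unitDisk, u z = toC (m z) := fun z => by simp [u, m]
  refine hloc_of_chart f φ' u ε δ hε hδ (hφ'c.mono fun x hx => (hεb x hx).2) ?_ ?_ ?_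
    (fun x hx => (hεb x hx).1) ?_
  · intro z hz
    obtain ⟨y, hy, rfl⟩ := hδb hz
    apply ContinuousAt.continuousWithinAt
    have : ContinuousAt (u ∘ Subtype.val) y := by
      have : u ∘ Subtype.val = fun z : unitDisk => toC (m z) := funext hum
      rw [this]
      exact (toC_cont hy).comp hm.continuousAt
    exact (hdo.isOpenEmbedding_subtypeVal.continuousAt_iff).1 this
  · intro x hx hx0 h
    have hxU : γ (x : OnePoint ℂ) ∈ U := (hεb x hx).2
    rw [hφ' x hxU, ← hφ0] at h
    have h := congrArg Subtype.val (φ.injective (Subtype.ext h))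
    simp only [← hγ] at h
    exact hx0 (OnePoint.coe_injective (γ.injective h))
  · intro z hz hz0 h
    obtain ⟨y, hy, rfl⟩ := hδb hz
    rw [hum] at h
    have h1 : m y = m ⟨0, h0⟩ := by rw [← coe_toC hy, h, hm0]
    have h2 := ψ.symm.injective (Subtype.ext (α.symm.injective h1))
    exact hz0 (congrArg Subtype.val h2)
  · intro x hx
    have hxU : γ (x : OnePoint ℂ) ∈ U := (hεb x hx).2
    rw [hφ' x hxU, ← hφψ ⟨γ (x : OnePoint ℂ), hxU⟩, hum]
    simp only [m, Homeomorph.symm_apply_apply]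
    rw [hf x, Homeomorph.symm_apply_apply, toC_coe]

lemma coord_square {F : Sph → Sph} (hF : IsThurstonMap F) (hd : HasDegreeTwo F) {c d : Sph}
    (hc : IsCriticalPt F c) (hd' : IsCriticalPt F d) (hcd : c ≠ d)
    (α : OnePoint ℂ ≃ₜ Sph) (hα : α OnePoint.infty = F c) (hα0 : α ((0 : ℂ) : OnePoint ℂ) = F d) :
    ∃ β : OnePoint ℂ ≃ₜ Sph, β OnePoint.infty = c ∧ β ((0 : ℂ) : OnePoint ℂ) = d ∧
      ∀ z : ℂ, F (β (z : OnePoint ℂ)) = α ((z ^ 2 : ℂ) : OnePoint ℂ) := by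
  obtain ⟨γ, hγ, hγ0⟩ := exists_coord c d hcd
  let g : OnePoint ℂ → OnePoint ℂ := fun x => α.symm (F (γ x))
  have hg : Continuous g := α.symm.continuous.comp (hF.1.1.comp γ.continuous)
  have hgi : g OnePoint.infty = OnePoint.infty := by simp [g, hγ, ← hα]
  have hgn : ∀ x : ℂ, g (x : OnePoint ℂ) ≠ OnePoint.infty := fun x h => by
    have h1 : F (γ (x : OnePoint ℂ)) = F c := by
      rw [← hα, ← h]; simp [g]
    have h2 := crit_fiber hF hd hc h1
    rw [← hγ] at h2
    exact OnePoint.coe_ne_infty x (γ.injective h2)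
  let f : ℂ → ℂ := fun x => toC (g (x : OnePoint ℂ))
  have hfg : ∀ x : ℂ, (f x : OnePoint ℂ) = g (x : OnePoint ℂ) := fun x => coe_toC (hgn x)
  have hfF : ∀ x : ℂ, F (γ (x : OnePoint ℂ)) = α (f x : OnePoint ℂ) := fun x => by
    rw [hfg]; simp [g]
  have hfc : Continuous f := cont_toC (hg.comp OnePoint.continuous_coe) hgn
  have hgo : IsOpenMap g := α.symm.isOpenMap.comp ((rc_open hF.1).comp γ.isOpenMap)
  have hfo : IsOpenMap f := by
    have h1 : IsOpenMap fun x : ℂ => (f x : OnePoint ℂ) := by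
      have : (fun x : ℂ => (f x : OnePoint ℂ)) = g ∘ (fun x : ℂ => (x : OnePoint ℂ)) :=
        funext hfg
      rw [this]; exact hgo.comp OnePoint.isOpenMap_coe
    intro s hs
    have h2 := (h1 s hs).preimage (OnePoint.continuous_coe (X := ℂ))
    convert h2 using 1
    ext y
    simp only [mem_image, mem_preimage]
    constructor
    · rintro ⟨x, hx, rfl⟩; exact ⟨x, hx, rfl⟩
    · rintro ⟨x, hx, h⟩; exact ⟨x, hx, OnePoint.coe_injective h⟩
  have hfp : Tendsto f (cocompact ℂ) (cocompact ℂ) := by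
    have h1 : Tendsto (fun x : ℂ => (f x : OnePoint ℂ)) (cocompact ℂ)
        (𝓝 (OnePoint.infty : OnePoint ℂ)) := by
      simp only [hfg]
      have h2 := hg.tendsto OnePoint.infty
      rw [hgi] at h2
      refine h2.comp ?_
      have := OnePoint.tendsto_coe_infty (X := ℂ)
      rwa [coclosedCompact_eq_cocompact] at this
    have h3 : Tendsto f (cocompact ℂ) (comap OnePoint.some (𝓝 (OnePoint.infty : OnePoint ℂ))) :=
      tendsto_comap_iff.2 h1
    rwa [OnePoint.comap_coe_nhds_infty, coclosedCompact_eq_cocompact] at h3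
  have hinj : ∀ x y : ℂ, f x = f y → F (γ (x : OnePoint ℂ)) = F (γ (y : OnePoint ℂ)) :=
    fun x y h => by rw [hfF, hfF, h]
  have hci : ∀ x y : ℂ, γ (x : OnePoint ℂ) = γ (y : OnePoint ℂ) → x = y := fun x y h =>
    OnePoint.coe_injective (γ.injective h)
  obtain ⟨s, hs⟩ := planar_homeo f hfc hfp hfo (by
      intro y
      obtain ⟨p, hp⟩ := rc_surj hF.1 (α (y : OnePoint ℂ))
      have h1 : γ.symm p ≠ OnePoint.infty := fun h => by
        have : p = c := by rw [← hγ, ← h, Homeomorph.apply_symm_apply]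
        rw [this, ← hα] at hp
        exact OnePoint.coe_ne_infty y (α.injective hp.symm)
      obtain ⟨x, hx⟩ := OnePoint.ne_infty_iff_exists.1 h1
      refine ⟨x, OnePoint.coe_injective (α.injective ?_)⟩
      rw [← hfF, hx, Homeomorph.apply_symm_apply, hp])
    (by
      have h0 : f 0 = 0 := OnePoint.coe_injective (α.injective (by
        rw [← hfF, hγ0, hα0]))
      intro x
      constructor
      · intro hx
        have h1 := hinj x 0 (by rw [hx, h0])
        rw [hγ0] at h1
        have h2 := crit_fiber hF hd hd' h1
        rw [← hγ0] at h2
        exact hci _ _ h2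
      · rintro rfl; exact h0)
    (by
      intro x y z h1 h2
      rcases fib_le_two hF hd _ _ _ (hinj x y h1) (hinj x z h2) with h | h | h
      · exact Or.inl (hci _ _ h)
      · exact Or.inr (Or.inl (hci _ _ h))
      · exact Or.inr (Or.inr (hci _ _ h)))
    (chart_hloc (ram_two hF hd hd') α γ hα0 hγ0 f hfF)
  have hs0 : s.symm 0 = 0 := by
    rw [Homeomorph.symm_apply_eq]
    have h0 : f 0 = 0 := OnePoint.coe_injective (α.injective (by
        rw [← hfF, hγ0, hα0]))
    have := hs 0
    rw [h0] at this
    exact (pow_eq_zero_iff two_ne_zero).1 this |>.symm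
  refine ⟨s.symm.onePointCongr.trans γ, hγ, ?_, ?_⟩
  · show γ ((s.symm 0 : ℂ) : OnePoint ℂ) = d
    rw [hs0, hγ0]
  · intro z
    show F (γ ((s.symm z : ℂ) : OnePoint ℂ)) = _
    rw [hfF, ← hs, Homeomorph.apply_symm_apply]

lemma nhds_infty_bd {s : Set (OnePoint ℂ)} (hs : s ∈ 𝓝 (OnePoint.infty : OnePoint ℂ)) :
    ∃ N : ℝ, ∀ w : ℂ, N < ‖w‖ → (w : OnePoint ℂ) ∈ s := by
  have h1 : OnePoint.some ⁻¹' s ∈ comap OnePoint.some (𝓝 (OnePoint.infty : OnePoint ℂ)) :=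
    preimage_mem_comap hs
  rw [OnePoint.comap_coe_nhds_infty, coclosedCompact_eq_cocompact,
    ← Metric.cobounded_eq_cocompact] at h1
  obtain ⟨N, -, hN⟩ := (Metric.hasBasis_cobounded_compl_closedBall (0 : ℂ)).mem_iff.1 h1
  exact ⟨N, fun w hw => hN (by simpa using hw)⟩

lemma nhds_infty_mk (M : ℝ) (s : Set (OnePoint ℂ)) (hi : OnePoint.infty ∈ s)
    (h : ∀ w : ℂ, M < ‖w‖ → (w : OnePoint ℂ) ∈ s) : s ∈ 𝓝 (OnePoint.infty : OnePoint ℂ) := by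
  have h1 : IsOpen (OnePoint.some '' (Metric.closedBall (0 : ℂ) M))ᶜ :=
    OnePoint.isOpen_compl_image_coe.2 ⟨Metric.isClosed_closedBall, isCompact_closedBall _ _⟩
  refine mem_of_superset (h1.mem_nhds ?_) ?_
  · rintro ⟨x, -, hx⟩; exact OnePoint.coe_ne_infty x hx
  · intro w hw
    by_cases hwi : w = OnePoint.infty
    · rw [hwi]; exact hi
    · obtain ⟨z, rfl⟩ := OnePoint.ne_infty_iff_exists.1 hwi
      exact h z (not_le.1 fun hz => hw ⟨z, by simpa using hz, rfl⟩)

lemma ext_one (K : ℂ → ℂ) (hK : Continuous K) (hp : ∀ N : ℝ, ∃ M : ℝ, ∀ w, M < ‖w‖ → N < ‖K w‖) :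
    ∃ k : C(OnePoint ℂ, OnePoint ℂ), k OnePoint.infty = OnePoint.infty ∧
      ∀ w : ℂ, k (w : OnePoint ℂ) = (K w : OnePoint ℂ) := by
  refine ⟨⟨OnePoint.map K, OnePoint.continuous_map hK ?_⟩, rfl, fun w => rfl⟩
  rw [coclosedCompact_eq_cocompact, ← Metric.cobounded_eq_cocompact, ← tendsto_norm_atTop_iff_cobounded]
  refine tendsto_atTop.2 fun N => ?_
  obtain ⟨M, hM⟩ := hp N
  have := (tendsto_norm_cobounded_atTop (E := ℂ)).eventually (eventually_gt_atTop M)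
  filter_upwards [this] with w hw
  exact (hM w hw).le

lemma homo_ext (H : unitInterval × ℂ → ℂ) (hc : Continuous H)
    (hp : ∀ N : ℝ, ∃ M : ℝ, ∀ t w, M < ‖w‖ → N < ‖H (t, w)‖)
    (k0 k1 : C(OnePoint ℂ, OnePoint ℂ)) (hk0 : k0 OnePoint.infty = OnePoint.infty)
    (hk1 : k1 OnePoint.infty = OnePoint.infty)
    (h0 : ∀ w : ℂ, k0 (w : OnePoint ℂ) = (H (0, w) : OnePoint ℂ))
    (h1 : ∀ w : ℂ, k1 (w : OnePoint ℂ) = (H (1, w) : OnePoint ℂ))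
    (T : Set (OnePoint ℂ)) (hT : ∀ t, ∀ w : ℂ, (w : OnePoint ℂ) ∈ T → H (t, w) = H (0, w)) :
    ContinuousMap.HomotopicRel k0 k1 T := by
  let E : unitInterval × OnePoint ℂ → OnePoint ℂ := fun p =>
    p.2.elim OnePoint.infty (fun w => (H (p.1, w) : OnePoint ℂ))
  have hE : Continuous E := by
    rw [continuous_iff_continuousAt]
    rintro ⟨t, w⟩
    by_cases hwi : w = OnePoint.infty
    · subst hwi
      intro s hs
      have hs : s ∈ 𝓝 (OnePoint.infty : OnePoint ℂ) := hs
      obtain ⟨N, hN⟩ := nhds_infty_bd hs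
      obtain ⟨M, hM⟩ := hp N
      rw [mem_map, nhds_prod_eq]
      refine mem_of_superset (prod_mem_prod univ_mem (nhds_infty_mk M
        ({OnePoint.infty} ∪ OnePoint.some '' {w : ℂ | M < ‖w‖}) (Or.inl rfl)
        fun w hw => Or.inr ⟨w, hw, rfl⟩)) ?_
      rintro ⟨t', w⟩ ⟨-, hw⟩
      rcases hw with hw | ⟨z, hz, hw⟩
      · have hw : w = OnePoint.infty := hw
        subst hw; exact (mem_of_mem_nhds hs : OnePoint.infty ∈ s)
      · have hw : (z : OnePoint ℂ) = w := hw
        subst hw; exact hN _ (hM t' z hz)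
    · obtain ⟨z, rfl⟩ := OnePoint.ne_infty_iff_exists.1 hwi
      have he : Topology.IsOpenEmbedding
          (Prod.map id OnePoint.some : unitInterval × ℂ → unitInterval × OnePoint ℂ) :=
        Topology.IsOpenEmbedding.id.prodMap OnePoint.isOpenEmbedding_coe
      refine (he.continuousAt_iff (x := (t, z)) (g := E)).1 ?_
      exact (OnePoint.continuous_coe.comp hc).continuousAt
  refine ⟨⟨⟨⟨E, hE⟩, ?_, ?_⟩, ?_⟩⟩
  · intro w
    induction w using OnePoint.rec with
    | infty => exact hk0.symm
    | coe w => exact (h0 w).symm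
  · intro w
    induction w using OnePoint.rec with
    | infty => exact hk1.symm
    | coe w => exact (h1 w).symm
  · intro t w hw
    induction w using OnePoint.rec with
    | infty => exact hk0.symm
    | coe w =>
      rw [h0]
      exact congrArg _ (hT t w hw)

lemma homo_id (K : ℂ → ℂ) (hK : Continuous K) (M : ℝ) (hM : ∀ w, M < ‖w‖ → K w = w)
    (k : C(OnePoint ℂ, OnePoint ℂ)) (hki : k OnePoint.infty = OnePoint.infty)
    (hk : ∀ w : ℂ, k (w : OnePoint ℂ) = (K w : OnePoint ℂ))
    (T : Set (OnePoint ℂ)) (hT : ∀ w : ℂ, (w : OnePoint ℂ) ∈ T → K w = w) :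
    ContinuousMap.HomotopicRel (ContinuousMap.id _) k T := by
  refine homo_ext (fun p => ((1 - (p.1 : ℝ) : ℝ) : ℂ) * p.2 + ((p.1 : ℝ) : ℂ) * K p.2)
    (by fun_prop) ?_ _ k rfl hki ?_ ?_ T ?_
  · intro N
    refine ⟨max N M, fun t w hw => ?_⟩
    have h1 := hM w ((le_max_right _ _).trans_lt hw)
    have h2 : ((1 - (t : ℝ) : ℝ) : ℂ) * w + ((t : ℝ) : ℂ) * w = w := by push_cast; ring
    simp only [h1, h2]
    exact (le_max_left _ _).trans_lt hw
  · intro w; simp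
  · intro w; simp [hk]
  · intro t w hw
    simp only [hT w hw]
    push_cast
    ring

lemma homo_neg (K : ℂ → ℂ) (hK : Continuous K) (M : ℝ) (hM : ∀ w, M < ‖w‖ → K w = -w)
    (k : C(OnePoint ℂ, OnePoint ℂ)) (hki : k OnePoint.infty = OnePoint.infty)
    (hk : ∀ w : ℂ, k (w : OnePoint ℂ) = (K w : OnePoint ℂ))
    (T : Set (OnePoint ℂ)) (hT : ∀ w : ℂ, (w : OnePoint ℂ) ∈ T → K w = w)
    (hTM : ∀ w : ℂ, (w : OnePoint ℂ) ∈ T → ‖w‖ ≤ M) :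
    ContinuousMap.HomotopicRel (ContinuousMap.id _) k T := by
  let χ : ℂ → ℝ := fun w => max 0 (min 1 (‖w‖ - M))
  have hχ : Continuous χ := by fun_prop
  have hχ0 : ∀ w, ‖w‖ ≤ M → χ w = 0 := fun w hw =>
    max_eq_left ((min_le_right _ _).trans (by linarith))
  have hχ1 : ∀ w, M + 1 < ‖w‖ → χ w = 1 := fun w hw => by
    simp only [χ]
    rw [min_eq_left (by linarith), max_eq_right zero_le_one]
  let H : unitInterval × ℂ → ℂ := fun p =>
    Complex.exp (((Real.pi * p.1 * χ p.2 : ℝ) : ℂ) * Complex.I) * K p.2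
  have hH : Continuous H := by fun_prop
  have hHn : ∀ p, ‖H p‖ = ‖K p.2‖ := fun p => by
    simp only [H, norm_mul, Complex.norm_exp_ofReal_mul_I, one_mul]
  have hp : ∀ N : ℝ, ∃ M : ℝ, ∀ t w, M < ‖w‖ → N < ‖H (t, w)‖ := by
    intro N
    refine ⟨max N M, fun t w hw => ?_⟩
    rw [hHn]
    simp only [hM w ((le_max_right _ _).trans_lt hw), norm_neg]
    exact (le_max_left _ _).trans_lt hw
  obtain ⟨k1, hk1i, hk1⟩ := ext_one (fun w => H (1, w)) (by fun_prop) (fun N => by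
    obtain ⟨M, hM⟩ := hp N
    exact ⟨M, hM 1⟩)
  have hc : ∀ t, ∀ w : ℂ, (w : OnePoint ℂ) ∈ T → H (t, w) = K w := fun t w hw => by
    simp [H, hχ0 w (hTM w hw)]
  have A := homo_ext H hH hp k k1 hki hk1i (fun w => by rw [hk]; simp [H]) hk1 T
    (fun t w hw => by rw [hc t w hw, hc 0 w hw])
  have B := homo_id (fun w => H (1, w)) (by fun_prop) (max M (M + 1)) (fun w hw => by
      have h1 := hM w ((le_max_left _ _).trans_lt hw)
      have h2 := hχ1 w ((le_max_right _ _).trans_lt hw)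
      simp [H, h1, h2, Complex.exp_pi_mul_I]) k1 hk1i hk1 T
    (fun w hw => by rw [hc 1 w hw, hT w hw])
  exact B.trans A.symm

lemma homo_conj (β : OnePoint ℂ ≃ₜ Sph) (k : C(OnePoint ℂ, OnePoint ℂ)) (P : Set Sph)
    (h : ContinuousMap.HomotopicRel (ContinuousMap.id _) k (β ⁻¹' P)) (φ ψ : C(Sph, Sph))
    (hφ : ∀ x, φ x = x) (hψ : ∀ x, ψ x = β (k (β.symm x))) :
    ContinuousMap.HomotopicRel φ ψ P := by
  obtain ⟨H⟩ := h
  refine ⟨⟨⟨⟨fun p => β (H (p.1, β.symm p.2)), by fun_prop⟩, ?_, ?_⟩, ?_⟩⟩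
  · intro x; simp [hφ]
  · intro x; simp [hψ]
  · intro t x hx
    have := H.eq_fst t (x := β.symm x) (by simpa using hx)
    simp only [ContinuousMap.id_apply] at this
    show β (H (t, β.symm x)) = φ x
    rw [this, hφ, Homeomorph.apply_symm_apply]

lemma crit_transfer {F G : Sph → Sph} (hG : IsThurstonMap G) {c : Sph} (hc : IsCriticalPt F c)
    {U : Set Sph} (hU : IsOpen U) (hcU : c ∈ U) (h : EqOn F G U) : IsCriticalPt G c := by
  by_contra hn
  obtain ⟨W, hW, hWe⟩ := loc_homeo hG.1 hn
  obtain ⟨k, hk2, hk⟩ := hc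
  obtain ⟨O, hO, hr⟩ := local_roots hk (inter_mem (hU.mem_nhds hcU) hW)
  obtain ⟨y, hyO, hy⟩ := ((sph_inf hO).sdiff (finite_singleton (F c))).nonempty
  obtain ⟨a, ha, hai⟩ := hr y hyO hy
  have h1 := hWe.injective (a₁ := ⟨a 0, (ha 0).1.2⟩) (a₂ := ⟨a 1, (ha 1).1.2⟩) (by
    show G (a 0) = G (a 1)
    rw [← h (ha 0).1.1, ← h (ha 1).1.1, (ha 0).2, (ha 1).2])
  have := hai (show 0 ∈ Iio k by simp; omega) (show 1 ∈ Iio k by simp; omega)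
    (congrArg Subtype.val h1)
  omega

lemma punct_conn (r : ℝ) (hr : 0 < r) : IsPreconnected {w : ℂ | w ≠ 0 ∧ ‖w‖ < r} := by
  have h1 := (hpl_convex (Real.log r)).isPreconnected.image Complex.exp
    Complex.continuous_exp.continuousOn
  convert h1 using 1
  ext w
  constructor
  · rintro ⟨h0, hw⟩
    refine ⟨Complex.log w, (hpl_exp hr).2 ?_, Complex.exp_log h0⟩
    rwa [Complex.exp_log h0]
  · rintro ⟨z, hz, rfl⟩
    exact ⟨Complex.exp_ne_zero z, (hpl_exp hr).1 hz⟩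

lemma outer_conn (R : ℝ) (hR : 0 < R) : IsPreconnected {w : ℂ | R < ‖w‖} := by
  have h1 := (punct_conn R⁻¹ (inv_pos.2 hR)).image (fun w => w⁻¹)
    (fun w hw => (continuousAt_inv₀ hw.1).continuousWithinAt)
  convert h1 using 1
  ext w
  constructor
  · intro hw
    have hw : R < ‖w‖ := hw
    have h0 : w ≠ 0 := norm_pos_iff.1 (hR.trans hw)
    refine ⟨w⁻¹, ⟨inv_ne_zero h0, ?_⟩, inv_inv w⟩
    rw [norm_inv]
    exact (inv_lt_inv₀ (hR.trans hw) hR).2 hw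
  · rintro ⟨z, ⟨hz0, hz⟩, rfl⟩
    show R < ‖z⁻¹‖
    rw [norm_inv]
    exact (lt_inv_comm₀ (norm_pos_iff.2 hz0) hR).1 hz

lemma sign_on (K : ℂ → ℂ) (hK : Continuous K) (S : Set ℂ) (hS : IsPreconnected S)
    (h0 : ∀ w ∈ S, w ≠ 0) (h : ∀ w ∈ S, K w ^ 2 = w ^ 2) :
    ∃ e : ℂ, (e = 1 ∨ e = -1) ∧ ∀ w ∈ S, K w = e * w := by
  rcases hS.eq_or_eq_neg_of_sq_eq (f := K) (g := id) hK.continuousOn continuousOn_id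
    (fun w hw => h w hw) (fun {w} hw => h0 w hw) with h | h
  · exact ⟨1, Or.inl rfl, fun w hw => by simpa using h hw⟩
  · exact ⟨-1, Or.inr rfl, fun w hw => by simpa using h hw⟩

lemma global_sign (K : ℂ → ℂ) (hK : Continuous K) (hK0 : K 0 = 0) (r R : ℝ) (hr : 0 < r)
    (hR : 0 < R) (h1 : ∀ w, ‖w‖ < r → K w ^ 2 = w ^ 2) (h2 : ∀ w, R < ‖w‖ → K w ^ 2 = w ^ 2)
    (Z : Set (OnePoint ℂ)) (hZ : IsPreconnected Z)
    (h3 : ∀ w : ℂ, (w : OnePoint ℂ) ∈ Z → K w ^ 2 = w ^ 2) :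
    ∃ e ei : ℂ, (e = 1 ∨ e = -1) ∧ (ei = 1 ∨ ei = -1) ∧ (∀ w, R < ‖w‖ → K w = ei * w) ∧
      (∀ w : ℂ, (w : OnePoint ℂ) ∈ Z → K w = e * w) ∧ (OnePoint.infty ∈ Z → e = ei) := by
  classical
  obtain ⟨e0, he0, hE0⟩ := sign_on K hK _ (punct_conn r hr) (fun w hw => hw.1)
    (fun w hw => h1 w hw.2)
  obtain ⟨ei, hei, hEi⟩ := sign_on K hK _ (outer_conn R hR)
    (fun w hw => norm_pos_iff.1 (hR.trans hw)) h2
  let q1 : ℂ → ℂ := fun w => if w = 0 then e0 else K w / w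
  let q : OnePoint ℂ → ℂ := fun w => w.elim ei q1
  have hq1 : Continuous q1 := by
    rw [continuous_iff_continuousAt]
    intro w
    by_cases hw : w = 0
    · subst hw
      have : q1 =ᶠ[𝓝 0] fun _ => e0 := by
        filter_upwards [Metric.ball_mem_nhds (0 : ℂ) hr] with w hw
        by_cases hw0 : w = 0
        · simp [q1, hw0]
        · simp only [q1, if_neg hw0]
          rw [hE0 w ⟨hw0, by simpa using hw⟩, mul_div_cancel_right₀ _ hw0]
      exact continuousAt_const.congr this.symm
    · have : q1 =ᶠ[𝓝 w] fun w => K w / w := by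
        filter_upwards [isOpen_ne.mem_nhds hw] with z hz
        simp only [q1, if_neg hz]
      exact (hK.continuousAt.div continuousAt_id hw).congr this.symm
  have hq : Continuous q := by
    rw [continuous_iff_continuousAt]
    intro w
    by_cases hwi : w = OnePoint.infty
    · subst hwi
      have : q =ᶠ[𝓝 OnePoint.infty] fun _ => ei := by
        refine nhds_infty_mk R _ rfl fun w hw => ?_
        show q1 w = ei
        have hw0 : w ≠ 0 := norm_pos_iff.1 (hR.trans hw)
        simp only [q1, if_neg hw0]
        rw [hEi w hw, mul_div_cancel_right₀ _ hw0]
      exact continuousAt_const.congr this.symm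
    · obtain ⟨z, rfl⟩ := OnePoint.ne_infty_iff_exists.1 hwi
      rw [OnePoint.continuousAt_coe]
      exact hq1.continuousAt
  have sq1 : ∀ e : ℂ, (e = 1 ∨ e = -1) → e ^ 2 = 1 := by
    rintro e (rfl | rfl) <;> norm_num
  have hqs : ∀ w ∈ Z, q w ^ 2 = 1 := by
    intro w hw
    by_cases hwi : w = OnePoint.infty
    · subst hwi; exact sq1 _ hei
    · obtain ⟨z, rfl⟩ := OnePoint.ne_infty_iff_exists.1 hwi
      show q1 z ^ 2 = 1
      by_cases hz : z = 0
      · simp only [q1, if_pos hz]; exact sq1 _ he0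
      · simp only [q1, if_neg hz]
        rw [div_pow, h3 z hw, div_self (pow_ne_zero 2 hz)]
  have key : ∀ e : ℂ, (∀ w ∈ Z, q w = e) →
      (∀ w : ℂ, (w : OnePoint ℂ) ∈ Z → K w = e * w) ∧ (OnePoint.infty ∈ Z → e = ei) := by
    intro e he
    refine ⟨fun w hw => ?_, fun hi => (he _ hi).symm⟩
    by_cases hw0 : w = 0
    · rw [hw0, hK0, mul_zero]
    · have h : q1 w = e := he _ hw
      simp only [q1, if_neg hw0] at h
      rw [← h, div_mul_cancel₀ _ hw0]
  rcases hZ.eq_or_eq_neg_of_sq_eq (f := q) (g := fun _ => (1 : ℂ)) hq.continuousOn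
    continuousOn_const (fun w hw => by simpa using hqs w hw) (fun {w} _ => one_ne_zero) with h | h
  · obtain ⟨a, b⟩ := key 1 (fun w hw => by simpa using h hw)
    exact ⟨1, ei, Or.inl rfl, hei, hEi, a, b⟩
  · obtain ⟨a, b⟩ := key (-1) (fun w hw => by simpa using h hw)
    exact ⟨-1, ei, Or.inr rfl, hei, hEi, a, b⟩

/-- Let `Z ⊆ S²` be compact, connected, locally connected and
non-separating.  If `F` and `G` are degree-2 Thurston maps with `F = G` on `Z`,
`P_F = P_G ⊆ Z`, and `F = G` on a neighborhood of each critical point of `F`, then `F` and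
`G` are Thurston equivalent. -/
theorem thurston_equiv_of_eq_on_nonseparating (Z : Set Sph)
    (hZcompact : IsCompact Z) (hZconn : IsConnected Z)
    (hZlc : LocallyConnectedSpace Z) (hZcompl : IsConnected Zᶜ)
    (F G : Sph → Sph)
    (hF : IsThurstonMap F) (hFdeg : HasDegreeTwo F)
    (hG : IsThurstonMap G) (hGdeg : HasDegreeTwo G)
    (hEq : Set.EqOn F G Z)
    (hP : postCritical F = postCritical G) (hPZ : postCritical F ⊆ Z)
    (hcrit : ∀ x : Sph, IsCriticalPt F x → ∃ U : Set Sph, IsOpen U ∧ x ∈ U ∧ Set.EqOn F G U) :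
    ThurstonEquiv F G := by
  obtain ⟨c, d, hc, hd, hcd⟩ := exists_two_crit hF hFdeg
  obtain ⟨U1, hU1, hcU1, hE1⟩ := hcrit c hc
  obtain ⟨U2, hU2, hdU2, hE2⟩ := hcrit d hd
  have hcG := crit_transfer hG hc hU1 hcU1 hE1
  have hdG := crit_transfer hG hd hU2 hdU2 hE2
  have hFcd : F c ≠ F d := fun h => hcd (crit_fiber hF hFdeg hd h)
  obtain ⟨α, hα, hα0⟩ := exists_coord _ _ hFcd
  obtain ⟨β, hβ, hβ0, hβs⟩ := coord_square hF hFdeg hc hd hcd α hα hα0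
  obtain ⟨γ, hγ, hγ0, hγs⟩ := coord_square hG hGdeg hcG hdG hcd α
    (hα.trans (hE1 hcU1)) (hα0.trans (hE2 hdU2))
  let L : OnePoint ℂ ≃ₜ OnePoint ℂ := γ.trans β.symm
  have hLi : L OnePoint.infty = OnePoint.infty := by
    show β.symm (γ OnePoint.infty) = _
    rw [hγ, ← hβ, Homeomorph.symm_apply_apply]
  have hL0 : L ((0 : ℂ) : OnePoint ℂ) = ((0 : ℂ) : OnePoint ℂ) := by
    show β.symm (γ _) = _
    rw [hγ0, ← hβ0, Homeomorph.symm_apply_apply]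
  have hLn : ∀ w : ℂ, L (w : OnePoint ℂ) ≠ OnePoint.infty := fun w h => by
    rw [← hLi] at h
    exact OnePoint.coe_ne_infty w (L.injective h)
  let K : ℂ → ℂ := fun w => toC (L (w : OnePoint ℂ))
  have hKL : ∀ w : ℂ, (K w : OnePoint ℂ) = L (w : OnePoint ℂ) := fun w => coe_toC (hLn w)
  have hK : Continuous K := cont_toC (L.continuous.comp OnePoint.continuous_coe) hLn
  have hK0 : K 0 = 0 := OnePoint.coe_injective (by rw [hKL, hL0])
  have hsq : ∀ w : ℂ, F (γ (w : OnePoint ℂ)) = G (γ (w : OnePoint ℂ)) → K w ^ 2 = w ^ 2 := by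
    intro w hw
    have h1 : β (K w : OnePoint ℂ) = γ (w : OnePoint ℂ) := by
      rw [hKL]; exact β.apply_symm_apply _
    rw [← h1, hβs, h1, hγs] at hw
    exact OnePoint.coe_injective (α.injective hw)
  obtain ⟨r, hr, hrK⟩ : ∃ r > 0, ∀ w, ‖w‖ < r → K w ^ 2 = w ^ 2 := by
    have h1 : (fun w : ℂ => γ (w : OnePoint ℂ)) ⁻¹' U2 ∈ 𝓝 (0 : ℂ) :=
      (hU2.preimage (γ.continuous.comp OnePoint.continuous_coe)).mem_nhds (by
        simpa [hγ0] using hdU2)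
    obtain ⟨r, hr, h⟩ := Metric.mem_nhds_iff.1 h1
    exact ⟨r, hr, fun w hw => hsq w (hE2 (h (mem_ball_zero_iff.2 hw)))⟩
  obtain ⟨R, hR, hRK⟩ : ∃ R > 0, ∀ w, R < ‖w‖ → K w ^ 2 = w ^ 2 := by
    have h1 : γ ⁻¹' U1 ∈ 𝓝 (OnePoint.infty : OnePoint ℂ) :=
      (hU1.preimage γ.continuous).mem_nhds (by simpa [hγ] using hcU1)
    obtain ⟨N, hN⟩ := nhds_infty_bd h1
    exact ⟨max N 1, lt_max_of_lt_right one_pos, fun w hw =>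
      hsq w (hE1 (hN w ((le_max_left _ _).trans_lt hw)))⟩
  have hZ' : IsPreconnected (γ ⁻¹' Z) := by
    have h1 := hZconn.isPreconnected.image _ γ.symm.continuous.continuousOn
    rwa [γ.symm.image_eq_preimage_symm] at h1
  obtain ⟨e, ei, he, hei, hKi, hKZ, hZi⟩ := global_sign K hK hK0 r R hr hR hrK hRK (γ ⁻¹' Z) hZ'
    (fun w hw => hsq w (hEq hw))
  have he2 : e * e = 1 := by rcases he with rfl | rfl <;> norm_num
  have he0 : e ≠ 0 := fun h => by simp [h] at he2
  let m : OnePoint ℂ ≃ₜ OnePoint ℂ := (Homeomorph.mulLeft₀ e he0).onePointCongr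
  have hmi : m OnePoint.infty = OnePoint.infty := rfl
  have hmw : ∀ w : ℂ, m (w : OnePoint ℂ) = ((e * w : ℂ) : OnePoint ℂ) := fun w => rfl
  let k : C(OnePoint ℂ, OnePoint ℂ) := ⟨fun w => m (L w), m.continuous.comp L.continuous⟩
  have hki : k OnePoint.infty = OnePoint.infty := by
    show m (L _) = _
    rw [hLi, hmi]
  have hkw : ∀ w : ℂ, k (w : OnePoint ℂ) = ((e * K w : ℂ) : OnePoint ℂ) := fun w => by
    show m (L _) = _
    rw [← hKL, hmw]
  have hT : ∀ w : ℂ, (w : OnePoint ℂ) ∈ γ ⁻¹' postCritical F → e * K w = w := fun w hw => by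
    rw [hKZ w (hPZ hw), ← mul_assoc, he2, one_mul]
  have hhom : ContinuousMap.HomotopicRel (ContinuousMap.id _) k (γ ⁻¹' postCritical F) := by
    by_cases hee : e = ei
    · refine homo_id (fun w => e * K w) (by fun_prop) R (fun w hw => ?_) k hki hkw _ hT
      show e * K w = w
      rw [hKi w hw, ← hee, ← mul_assoc, he2, one_mul]
    · have hiZ : OnePoint.infty ∉ γ ⁻¹' Z := fun h => hee (hZi h)
      have hem : e * ei = -1 := by
        rcases he with rfl | rfl <;> rcases hei with rfl | rfl <;> simp_all
      obtain ⟨N, hN⟩ := nhds_infty_bd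
        ((hZcompact.isClosed.preimage γ.continuous).isOpen_compl.mem_nhds hiZ)
      refine homo_neg (fun w => e * K w) (by fun_prop) (max R N) (fun w hw => ?_) k hki hkw _ hT
        (fun w hw => ?_)
      · show e * K w = -w
        rw [hKi w ((le_max_left _ _).trans_lt hw), ← mul_assoc, hem, neg_one_mul]
      · by_contra! h
        exact hN w ((le_max_right _ _).trans_lt h) (hPZ hw)
  refine ⟨Homeomorph.refl _, β.symm.trans (m.trans γ), fun x => ?_, ?_⟩
  · show F x = G (γ (m (β.symm x)))
    obtain ⟨w, rfl⟩ := β.surjective x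
    rw [Homeomorph.symm_apply_apply]
    by_cases hwi : w = OnePoint.infty
    · subst hwi
      rw [hmi, hγ, hβ, hE1 hcU1]
    · obtain ⟨z, rfl⟩ := OnePoint.ne_infty_iff_exists.1 hwi
      rw [hmw, hγs, hβs, mul_pow, pow_two e, he2, one_mul]
  · refine homo_conj γ k _ hhom _ _ (fun x => rfl) (fun x => ?_)
    show γ (m (β.symm x)) = γ (m (β.symm (γ (γ.symm x))))
    rw [Homeomorph.apply_symm_apply]
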